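/- Let W be a suitable basis of A at {β₁,…,β_I}. Let e, ẽ ∈ C[x] and M, M̃ ∈ C[x]^{r×r} be such that SW = (1/e)·MW, the gcd of e together with all entries of M equals 1, (1/ẽ)·M̃ = ((1/e)·M)^{−1}, and the gcd of ẽ together with all entries of M̃ equals 1. Let p_i ∈ C[x] be the minimal polynomial of β_i over C. Let a ∈ C[x]^r and ℓ ∈ ℤ. If q = p_i^m for some i ∈ {1,…,I} and some integer m > 0, then there exist g ∈ A and c ∈ C[x]^r such that (1/σ^ℓ(q))·aW = Δg + (1/(q·e·ẽ))·cW. -/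

import Mathlib

set_option maxHeartbeats 1000000
set_option synthInstance.maxHeartbeats 200000

open Polynomial Filter

noncomputable section

namespace PRec

variable (C : Type*) [Field C] [CharZero C]

/-- The algebraic closure of the coefficient field. -/
abbrev Cbar := AlgebraicClosure C

/-- The field of formal Laurent series over the algebraic closure. -/
abbrev LS := LaurentSeries (Cbar C)

/-- The Laurent-series variable `q`. -/
def qv : LS C := HahnSeries.single 1 1

open Classical in
/-- The valuation `ν_q`, with `ν_q 0 = ⊤`, valued in the extended reals. -/
def nuq (a : LS C) : EReal := if a = 0 then ⊤ else (((a.order : ℤ) : ℝ) : EReal)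

/-- Evaluation of a rational function at the point `α + m + q`. -/
def evalAt (α : Cbar C) (m : ℤ) (p : RatFunc C) : LS C :=
  RatFunc.eval ((algebraMap (Cbar C) (LS C)).comp (algebraMap C (Cbar C)))
    (algebraMap (Cbar C) (LS C) α + (m : LS C) + qv C) p

/-- Shorthand for the canonical map `C[x] → C(x)`. -/
abbrev toRat : Polynomial C →+* RatFunc C := algebraMap (Polynomial C) (RatFunc C)

variable (ℓ : ℕ → Polynomial C) (r : ℕ)

/-- The solution space `Sol_α(L)` of `L = ℓ₀ + ℓ₁ S + ⋯ + ℓ_r S^r` at `α`,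
indexed so that `b n` stands for the value of the solution at `α + n`. -/
def SolSet (α : Cbar C) : Set (ℤ → LS C) :=
  {b | ∀ n : ℤ, ∑ i ∈ Finset.range (r + 1),
      evalAt C α n (toRat C (ℓ i)) * b (n + i) = 0}

/-- The action of an element `f = f₀ + f₁ S + ⋯ + f_{r-1} S^{r-1}` of
`A = C(x)[S]/⟨L⟩` (represented by its coefficient vector) on a sequence. -/
def elemApply (α : Cbar C) (f : Fin r → RatFunc C) (b : ℤ → LS C) : ℤ → LS C :=
  fun n => ∑ i : Fin r, evalAt C α n (f i) * b (n + (i : ℤ))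

/-- Truncated subtraction on extended reals with the convention `⊤ - ⊤ = ⊤`. -/
def esub (a b : EReal) : EReal := if b = ⊤ then ⊤ else a - b

/-- The value function `val_α` on `A`. -/
def valAt (α : Cbar C) (f : Fin r → RatFunc C) : EReal :=
  ⨅ b ∈ SolSet C ℓ r α,
    esub (nuq C (elemApply C r α f b 0))
      (Filter.liminf (fun n : ℕ => nuq C (b (-(n : ℤ)))) Filter.atTop)

/-- `f ∈ A` is (locally) integral at `α`. -/
def IntegralAt (α : Cbar C) (f : Fin r → RatFunc C) : Prop :=
  0 ≤ valAt C ℓ r α f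

/-- Membership in the local subring `C(x)_α` of rational functions having no pole at `α`. -/
def InLocalRing (α : Cbar C) (f : RatFunc C) : Prop :=
  ∃ p q : Polynomial C, (Polynomial.aeval α) q ≠ 0 ∧ f = toRat C p / toRat C q

/-- `W` is a `C(x)`-vector space basis of `A` (represented on coefficient vectors). -/
def IsVSBasis (W : Fin r → (Fin r → RatFunc C)) : Prop :=
  LinearIndependent (RatFunc C) W ∧
    Submodule.span (RatFunc C) (Set.range W) = (⊤ : Submodule (RatFunc C) (Fin r → RatFunc C))

/-- The `C(x)_α`-span of a tuple of elements of `A`. -/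
def localSpan (α : Cbar C) (W : Fin r → (Fin r → RatFunc C)) :
    Set (Fin r → RatFunc C) :=
  {f | ∃ c : Fin r → RatFunc C, (∀ i, InLocalRing C α (c i)) ∧ f = ∑ i, c i • W i}

/-- `W` is a local integral basis of `A` at `α`. -/
def IsLocalIntegralBasis (α : Cbar C) (W : Fin r → (Fin r → RatFunc C)) : Prop :=
  IsVSBasis C r W ∧ (∀ i, IntegralAt C ℓ r α (W i)) ∧
    ∀ f : Fin r → RatFunc C, IntegralAt C ℓ r α f → f ∈ localSpan C r α W

/-- The standard basis `1, S, …, S^{r-1}` of `A`. -/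
def stdBasis : Fin r → (Fin r → RatFunc C) :=
  fun i j => if j = i then 1 else 0

/-- The shift automorphism `p(x) ↦ p(x+c)` of the polynomial ring. -/
def polyShiftEquiv (c : C) : Polynomial C ≃+* Polynomial C where
  toFun p := p.comp (X + Polynomial.C c)
  invFun p := p.comp (X - Polynomial.C c)
  left_inv p := by
    show (p.comp (X + Polynomial.C c)).comp (X - Polynomial.C c) = p
    rw [Polynomial.comp_assoc]; simp
  right_inv p := by
    show (p.comp (X - Polynomial.C c)).comp (X + Polynomial.C c) = p
    rw [Polynomial.comp_assoc]; simp
  map_add' p q := by simp [Polynomial.add_comp]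
  map_mul' p q := by simp [Polynomial.mul_comp]

/-- The shift `σ^k`, `p(x) ↦ p(x+k)`, on polynomials, for `k : ℤ`. -/
def polyShift (k : ℤ) (p : Polynomial C) : Polynomial C := polyShiftEquiv C (k : C) p

/-- `σ` on polynomials. -/
def polyσ : Polynomial C ≃+* Polynomial C := polyShiftEquiv C 1

/-- The shift automorphism `σ : f(x) ↦ f(x+1)` of the rational function field. -/
def ratσ : RatFunc C →+* RatFunc C :=
  RatFunc.mapRingHom (polyσ C : Polynomial C →+* Polynomial C)
    (by
      intro p hp
      simp only [Submonoid.mem_comap]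
      refine mem_nonZeroDivisors_iff_ne_zero.mpr ?_
      have hp0 : p ≠ 0 := mem_nonZeroDivisors_iff_ne_zero.mp hp
      simpa using (map_ne_zero_iff _ (polyσ C).injective).mpr hp0)

variable [NeZero r]

/-- The index `r - 1` as an element of `Fin r`. -/
def lastIdx : Fin r := ⟨r - 1, Nat.sub_lt (Nat.pos_of_ne_zero (NeZero.ne r)) one_pos⟩

/-- The action of `S` on `A = C(x)[S]/⟨L⟩`, on coefficient vectors with respect to the
basis `1, S, …, S^{r-1}`, using `S^r = -(ℓ₀/ℓ_r) - ⋯ - (ℓ_{r-1}/ℓ_r) S^{r-1}`. -/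
def Smap (f : Fin r → RatFunc C) : Fin r → RatFunc C :=
  fun j =>
    (if (j : ℕ) = 0 then 0 else
      ratσ C (f ⟨(j : ℕ) - 1, lt_of_le_of_lt (Nat.sub_le _ _) j.isLt⟩))
      - ratσ C (f (lastIdx r)) * (toRat C (ℓ j) / toRat C (ℓ r))

/-- The difference operator `Δ = S - 1` on `A`. -/
def Dmap (f : Fin r → RatFunc C) : Fin r → RatFunc C :=
  Smap C ℓ r f - f

/-- `f ∈ A` is summable. -/
def IsSummable (f : Fin r → RatFunc C) : Prop :=
  ∃ g : Fin r → RatFunc C, f = Dmap C ℓ r g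

/-- `disp_α(p) ≥ k`: `p` has two roots in `α + ℤ` at distance `k`. -/
def DispGe (α : Cbar C) (p : Polynomial (Cbar C)) (k : ℕ) : Prop :=
  ∃ m : ℤ, Polynomial.eval (α + (m : Cbar C)) p = 0 ∧
    Polynomial.eval (α + (m : Cbar C) + (k : Cbar C)) p = 0

/-- The dispersion `disp_α(p)` as an extended natural number
(`0` by convention for the empty set, which is excluded by the hypotheses below). -/
def dispVal (α : Cbar C) (p : Polynomial (Cbar C)) : ℕ∞ :=
  sSup ((fun k : ℕ => (k : ℕ∞)) '' {k : ℕ | DispGe C α p k})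

/-- A polynomial is shift-free if it is coprime to each of its nontrivial shifts. -/
def ShiftFree {K : Type*} [Field K] [CharZero K] (p : Polynomial K) : Prop :=
  ∀ k : ℤ, k ≠ 0 → IsCoprime p (p.comp (X + Polynomial.C (k : K)))

/-- The data of the orbits `α_i + ℤ` of the roots of `ℓ₀ℓ_r`, with the minimal root
`minR i = α_{i,1}`, the maximal root `maxR i = α_{i,J_i}`, and the chosen bounds `β i`. -/
structure SuitableData (I : ℕ) where
  β : Fin I → Cbar C
  minR : Fin I → Cbar C
  maxR : Fin I → Cbar C
  minR_root : ∀ i, (Polynomial.aeval (minR i)) (ℓ 0 * ℓ r) = 0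
  maxR_root : ∀ i, (Polynomial.aeval (maxR i)) (ℓ 0 * ℓ r) = 0
  minR_le_maxR : ∀ i, ∃ m : ℕ, maxR i = minR i + (m : Cbar C)
  maxR_le_β : ∀ i, ∃ m : ℕ, β i = maxR i + (m : Cbar C)
  roots_between : ∀ i (m : ℤ), (Polynomial.aeval (minR i + (m : Cbar C))) (ℓ 0 * ℓ r) = 0 →
    0 ≤ m ∧ ∃ k : ℕ, maxR i = minR i + (m : Cbar C) + (k : Cbar C)
  orbits_distinct : ∀ i i', i ≠ i' → ∀ m : ℤ, β i ≠ β i' + (m : Cbar C)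
  orbits_cover : ∀ ξ : Cbar C, (Polynomial.aeval ξ) (ℓ 0 * ℓ r) = 0 →
    ∃ i, ∃ m : ℤ, ξ = β i + (m : Cbar C)
  conj_compat : ∀ (φ : Cbar C ≃ₐ[C] Cbar C) (i i' : Fin I), φ (maxR i) = maxR i' →
    β i - maxR i = β i' - maxR i'

/-- Membership in `Z = ⋃ᵢ {γ ∈ αᵢ + ℤ : α_{i,1} < γ ≤ βᵢ}`. -/
def memZ {I : ℕ} (D : SuitableData C ℓ r I) (γ : Cbar C) : Prop :=
  ∃ i, (∃ m : ℕ, γ + (m : Cbar C) = D.β i) ∧ (∃ k : ℕ, 1 ≤ k ∧ γ = D.minR i + (k : Cbar C))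

/-- `W` is a suitable basis of `A` at `{β₁, …, β_I}`. -/
def IsSuitableBasis {I : ℕ} (D : SuitableData C ℓ r I) (W : Fin r → (Fin r → RatFunc C)) :
    Prop :=
  IsVSBasis C r W ∧
    (∀ γ : Cbar C, memZ C ℓ r D γ → IsLocalIntegralBasis C ℓ r γ W) ∧
    (∀ γ : Cbar C, ¬ memZ C ℓ r D γ → localSpan C r γ W = localSpan C r γ (stdBasis C r))

set_option linter.unusedSectionVars false

section Evaluation

variable {C}

/-- Evaluation of polynomials at `α + n + q`, through power series. -/
def psEval (α : Cbar C) (n : ℤ) : Polynomial C →+* PowerSeries (Cbar C) :=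
  Polynomial.eval₂RingHom ((PowerSeries.C (R := Cbar C)).comp (algebraMap C (Cbar C)))
    (PowerSeries.C (α + n) + PowerSeries.X)

lemma psEval_eq_coe (α : Cbar C) (n : ℤ) (p : Polynomial C) :
    psEval α n p = (((p.map (algebraMap C (Cbar C))).comp
      (X + Polynomial.C (α + (n : Cbar C))) : Polynomial (Cbar C)) : PowerSeries (Cbar C)) := by
  induction p using Polynomial.induction_on' with
  | add p q hp hq => simp [map_add, hp, hq, Polynomial.add_comp]
  | monomial k a =>
    rw [psEval, Polynomial.coe_eval₂RingHom, Polynomial.eval₂_monomial, Polynomial.map_monomial,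
      ← Polynomial.C_mul_X_pow_eq_monomial, Polynomial.mul_comp, Polynomial.C_comp,
      Polynomial.X_pow_comp, Polynomial.coe_mul, Polynomial.coe_C, Polynomial.coe_pow,
      Polynomial.coe_add, Polynomial.coe_X, Polynomial.coe_C, add_comm PowerSeries.X]
    rfl

lemma psEval_ne_zero (α : Cbar C) (n : ℤ) {p : Polynomial C} (hp : p ≠ 0) :
    psEval α n p ≠ 0 := by
  rw [psEval_eq_coe]
  intro h
  have h1 := Polynomial.coe_injective (Cbar C) (h.trans (Polynomial.coe_zero).symm)
  rw [Polynomial.comp_X_add_C_eq_zero_iff, Polynomial.map_eq_zero] at h1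
  exact hp h1

lemma constantCoeff_psEval (α : Cbar C) (n : ℤ) (p : Polynomial C) :
    PowerSeries.constantCoeff (psEval α n p) = Polynomial.aeval (α + (n : Cbar C)) p := by
  rw [psEval, Polynomial.coe_eval₂RingHom, Polynomial.hom_eval₂, Polynomial.aeval_def]
  congr 1
  simp

/-- Evaluation of polynomials at `α + n + q`. -/
def lsEval (α : Cbar C) (n : ℤ) : Polynomial C →+* LS C :=
  (HahnSeries.ofPowerSeries ℤ (Cbar C)).comp (psEval α n)

lemma lsEval_eq_eval₂ (α : Cbar C) (n : ℤ) (p : Polynomial C) :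
    lsEval α n p = p.eval₂ ((algebraMap (Cbar C) (LS C)).comp (algebraMap C (Cbar C)))
      (algebraMap (Cbar C) (LS C) α + (n : LS C) + qv C) := by
  have hC : (HahnSeries.ofPowerSeries ℤ (Cbar C)).comp (PowerSeries.C (R := Cbar C))
      = algebraMap (Cbar C) (LS C) := by
    rfl
  rw [lsEval, RingHom.comp_apply, psEval, Polynomial.coe_eval₂RingHom, Polynomial.hom_eval₂,
    ← RingHom.comp_assoc, hC]
  congr 1
  rw [map_add, ← RingHom.comp_apply, hC, HahnSeries.ofPowerSeries_X, map_add, map_intCast, qv]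

lemma lsEval_ne_zero (α : Cbar C) (n : ℤ) {p : Polynomial C} (hp : p ≠ 0) :
    lsEval α n p ≠ 0 := fun h =>
  psEval_ne_zero α n hp ((map_eq_zero_iff _ HahnSeries.ofPowerSeries_injective).mp h)

/-- Evaluation of rational functions at `α + n + q`, as a ring homomorphism. -/
def evalHom (α : Cbar C) (n : ℤ) : RatFunc C →+* LS C :=
  RatFunc.liftRingHom (lsEval α n) (fun _ hp =>
    mem_nonZeroDivisors_of_ne_zero (lsEval_ne_zero α n (nonZeroDivisors.ne_zero hp)))

lemma evalHom_toRat (α : Cbar C) (n : ℤ) (p : Polynomial C) :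
    evalHom α n (toRat C p) = lsEval α n p := by
  exact RatFunc.liftRingHom_algebraMap _ _ p

lemma evalAt_eq_evalHom (α : Cbar C) (n : ℤ) (f : RatFunc C) :
    evalAt C α n f = evalHom α n f := by
  conv_rhs => rw [← RatFunc.num_div_denom f]
  rw [map_div₀, evalHom_toRat, evalHom_toRat, lsEval_eq_eval₂, lsEval_eq_eval₂]
  rfl

lemma ratσ_toRat (p : Polynomial C) : ratσ C (toRat C p) = toRat C (polyσ C p) := by
  have h := RatFunc.map_apply_div (polyσ C : Polynomial C →+* Polynomial C) (by
      intro p hp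
      simp only [Submonoid.mem_comap]
      refine mem_nonZeroDivisors_iff_ne_zero.mpr ?_
      have hp0 : p ≠ 0 := mem_nonZeroDivisors_iff_ne_zero.mp hp
      simpa using (map_ne_zero_iff _ (polyσ C).injective).mpr hp0) p 1
  rw [map_one, div_one, map_one, map_one, div_one] at h
  exact h

lemma aeval_polyShift (k : ℤ) (ξ : Cbar C) (p : Polynomial C) :
    Polynomial.aeval ξ (polyShift C k p) = Polynomial.aeval (ξ + (k : Cbar C)) p := by
  change Polynomial.aeval ξ (p.comp _) = _
  rw [Polynomial.aeval_comp]
  simp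

lemma polyσ_eq (p : Polynomial C) : polyσ C p = polyShift C 1 p := by
  simp [polyσ, polyShift]

lemma polyσ_symm_eq (p : Polynomial C) : (polyσ C).symm p = polyShift C (-1) p := by
  change p.comp (X - Polynomial.C 1) = p.comp (X + Polynomial.C (((-1 : ℤ)) : C))
  simp [sub_eq_add_neg]

lemma polyσ_polyShift (k : ℤ) (p : Polynomial C) :
    polyσ C (polyShift C k p) = polyShift C (k + 1) p := by
  change (p.comp (X + Polynomial.C (k : C))).comp (X + Polynomial.C 1)
    = p.comp (X + Polynomial.C ((k + 1 : ℤ) : C))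
  rw [Polynomial.comp_assoc]
  congr 1
  simp
  ring

lemma polyShift_zero (p : Polynomial C) : polyShift C 0 p = p := by
  change p.comp (X + Polynomial.C ((0 : ℤ) : C)) = p
  simp

lemma aeval_polyσ (ξ : Cbar C) (p : Polynomial C) :
    Polynomial.aeval ξ (polyσ C p) = Polynomial.aeval (ξ + 1) p := by
  rw [polyσ_eq, aeval_polyShift]; simp

lemma aeval_polyσ_symm (ξ : Cbar C) (p : Polynomial C) :
    Polynomial.aeval ξ ((polyσ C).symm p) = Polynomial.aeval (ξ - 1) p := by
  rw [polyσ_symm_eq, aeval_polyShift]; simp [sub_eq_add_neg]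

lemma lsEval_polyσ (α : Cbar C) (n : ℤ) (p : Polynomial C) :
    lsEval α n (polyσ C p) = lsEval (α + 1) n p := by
  rw [lsEval_eq_eval₂, lsEval_eq_eval₂]
  change (p.comp (X + Polynomial.C 1)).eval₂ _ _ = _
  rw [Polynomial.eval₂_comp]
  congr 1
  simp
  ring

lemma evalAt_ratσ (α : Cbar C) (n : ℤ) (f : RatFunc C) :
    evalAt C α n (ratσ C f) = evalAt C (α + 1) n f := by
  rw [evalAt_eq_evalHom, evalAt_eq_evalHom, ← RatFunc.num_div_denom f, map_div₀, map_div₀,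
    map_div₀, ratσ_toRat, ratσ_toRat]
  simp only [evalHom_toRat, lsEval_polyσ]

lemma evalAt_add_one (α : Cbar C) (n : ℤ) (f : RatFunc C) :
    evalAt C (α + 1) n f = evalAt C α (n + 1) f := by
  unfold evalAt
  congr 1
  simp
  ring

end Evaluation

section LocalRing

variable {C}

lemma inLocalRing_toRat (α : Cbar C) (p : Polynomial C) : InLocalRing C α (toRat C p) :=
  ⟨p, 1, by simp, by simp⟩

lemma ne_zero_of_aeval_ne_zero {α : Cbar C} {p : Polynomial C} (h : Polynomial.aeval α p ≠ 0) :
    p ≠ 0 := by rintro rfl; simp at h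

lemma toRat_ne_zero {p : Polynomial C} (h : p ≠ 0) : toRat C p ≠ 0 :=
  RatFunc.algebraMap_ne_zero h

lemma InLocalRing.mul {α : Cbar C} {f g : RatFunc C} (hf : InLocalRing C α f)
    (hg : InLocalRing C α g) : InLocalRing C α (f * g) := by
  obtain ⟨p, q, hq, rfl⟩ := hf
  obtain ⟨p', q', hq', rfl⟩ := hg
  exact ⟨p * p', q * q', by simp [hq, hq'], by simp [div_mul_div_comm]⟩

lemma InLocalRing.add {α : Cbar C} {f g : RatFunc C} (hf : InLocalRing C α f)
    (hg : InLocalRing C α g) : InLocalRing C α (f + g) := by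
  obtain ⟨p, q, hq, rfl⟩ := hf
  obtain ⟨p', q', hq', rfl⟩ := hg
  refine ⟨p * q' + q * p', q * q', by simp [hq, hq'], ?_⟩
  rw [div_add_div _ _ (toRat_ne_zero (ne_zero_of_aeval_ne_zero hq))
    (toRat_ne_zero (ne_zero_of_aeval_ne_zero hq'))]
  simp

lemma InLocalRing.neg {α : Cbar C} {f : RatFunc C} (hf : InLocalRing C α f) :
    InLocalRing C α (-f) := by
  obtain ⟨p, q, hq, rfl⟩ := hf
  exact ⟨-p, q, hq, by simp [neg_div]⟩

lemma InLocalRing.sub {α : Cbar C} {f g : RatFunc C} (hf : InLocalRing C α f)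
    (hg : InLocalRing C α g) : InLocalRing C α (f - g) := by
  rw [sub_eq_add_neg]
  exact hf.add hg.neg

lemma inLocalRing_zero (α : Cbar C) : InLocalRing C α 0 := by
  simpa using inLocalRing_toRat α (0 : Polynomial C)

lemma inLocalRing_one (α : Cbar C) : InLocalRing C α 1 := by
  simpa using inLocalRing_toRat α (1 : Polynomial C)

lemma inLocalRing_ratσ_iff {α : Cbar C} {f : RatFunc C} :
    InLocalRing C α (ratσ C f) ↔ InLocalRing C (α + 1) f := by
  constructor
  · rintro ⟨p, q, hq, h⟩
    refine ⟨(polyσ C).symm p, (polyσ C).symm q, by simpa [aeval_polyσ_symm] using hq, ?_⟩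
    apply (ratσ C).injective
    rw [h, map_div₀, ratσ_toRat, ratσ_toRat]
    simp
  · rintro ⟨p, q, hq, rfl⟩
    exact ⟨polyσ C p, polyσ C q, by rwa [aeval_polyσ], by rw [map_div₀, ratσ_toRat, ratσ_toRat]⟩

/-- A common denominator without superfluous factors does not vanish where all the
fractions are regular. -/
lemma aeval_ne_zero_of_inLocalRing {ι : Type*} {α : Cbar C} {e : Polynomial C} (he : e ≠ 0)
    {M : Matrix ι ι (Polynomial C)}
    (hgcd : ∀ d : Polynomial C, d ∣ e → (∀ i j, d ∣ M i j) → IsUnit d)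
    (h : ∀ i j, InLocalRing C α (toRat C (M i j) / toRat C e)) :
    Polynomial.aeval α e ≠ 0 := by
  intro h0
  refine minpoly.not_isUnit C α (hgcd _ (minpoly.dvd C α h0) fun i j => minpoly.dvd C α ?_)
  obtain ⟨p, q, hq, hpq⟩ := h i j
  rw [div_eq_div_iff (toRat_ne_zero he) (toRat_ne_zero (ne_zero_of_aeval_ne_zero hq)),
    ← map_mul, ← map_mul] at hpq
  have h1 := congrArg (Polynomial.aeval α) (RatFunc.algebraMap_injective C hpq)
  rw [map_mul, map_mul, h0, mul_zero] at h1
  exact (mul_eq_zero.mp h1).resolve_right hq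

lemma exists_powerSeries_evalAt {α : Cbar C} {n : ℤ} {f : RatFunc C}
    (hf : InLocalRing C (α + (n : Cbar C)) f) :
    ∃ u : PowerSeries (Cbar C), evalAt C α n f = HahnSeries.ofPowerSeries ℤ (Cbar C) u := by
  obtain ⟨p, q, hq, rfl⟩ := hf
  refine ⟨psEval α n p * (psEval α n q)⁻¹, ?_⟩
  have hq0 : PowerSeries.constantCoeff (psEval α n q) ≠ 0 := by rwa [constantCoeff_psEval]
  rw [evalAt_eq_evalHom, map_div₀, evalHom_toRat, evalHom_toRat,
    div_eq_iff (lsEval_ne_zero α n (ne_zero_of_aeval_ne_zero hq)), lsEval, RingHom.comp_apply,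
    RingHom.comp_apply, ← map_mul, mul_assoc, PowerSeries.inv_mul_cancel _ hq0, mul_one]

end LocalRing

section Valuation

variable {C}

lemma le_nuq_iff {v : EReal} {a : LS C} :
    v ≤ nuq C a ↔ ∀ n : ℤ, a.coeff n ≠ 0 → v ≤ ((n : ℝ) : EReal) := by
  unfold nuq
  split_ifs with h
  · simp [h]
  · refine ⟨fun hv n hn => hv.trans ?_, fun H => H _ (mt HahnSeries.coeff_order_eq_zero.mp h)⟩
    exact EReal.coe_le_coe_iff.mpr (Int.cast_le.mpr (HahnSeries.order_le_of_coeff_ne_zero hn))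

lemma nuq_ne_bot (a : LS C) : nuq C a ≠ ⊥ := by
  unfold nuq
  split_ifs <;> simp

lemma le_nuq_zero (v : EReal) : v ≤ nuq C 0 := by
  simp [nuq]

lemma le_nuq_add {v : EReal} {a b : LS C} (ha : v ≤ nuq C a) (hb : v ≤ nuq C b) :
    v ≤ nuq C (a + b) := by
  rw [le_nuq_iff] at *
  intro n hn
  by_cases h : a.coeff n = 0
  · exact hb n (by simpa [h] using hn)
  · exact ha n h

lemma le_nuq_neg {v : EReal} {a : LS C} (ha : v ≤ nuq C a) : v ≤ nuq C (-a) := by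
  rw [le_nuq_iff] at *
  exact fun n hn => ha n (by simpa using hn)

lemma le_nuq_sum {ι : Type*} {v : EReal} (s : Finset ι) {a : ι → LS C}
    (ha : ∀ i ∈ s, v ≤ nuq C (a i)) : v ≤ nuq C (∑ i ∈ s, a i) :=
  Finset.sum_induction _ (fun x => v ≤ nuq C x) (fun _ _ => le_nuq_add) (le_nuq_zero v) ha

lemma le_nuq_ofPowerSeries_mul {v : EReal} {a : LS C} (u : PowerSeries (Cbar C))
    (ha : v ≤ nuq C a) : v ≤ nuq C (HahnSeries.ofPowerSeries ℤ (Cbar C) u * a) := by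
  by_cases ha0 : a = 0
  · simpa [ha0] using le_nuq_zero v
  by_cases hu : HahnSeries.ofPowerSeries ℤ (Cbar C) u = 0
  · simpa [hu] using le_nuq_zero v
  refine ha.trans ?_
  rw [nuq, if_neg ha0, nuq, if_neg (mul_ne_zero hu ha0), HahnSeries.order_mul hu ha0]
  have h0 : 0 ≤ (HahnSeries.ofPowerSeries ℤ (Cbar C) u).order := by
    by_contra! hlt
    have := mt HahnSeries.coeff_order_eq_zero.mp hu
    rw [PowerSeries.coeff_coe, if_pos hlt] at this
    exact this rfl
  exact EReal.coe_le_coe_iff.mpr (Int.cast_le.mpr (by linarith))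

lemma le_nuq_evalAt_mul {v : EReal} {α : Cbar C} {n : ℤ} {f : RatFunc C} {a : LS C}
    (hf : InLocalRing C (α + (n : Cbar C)) f) (ha : v ≤ nuq C a) :
    v ≤ nuq C (evalAt C α n f * a) := by
  obtain ⟨u, hu⟩ := exists_powerSeries_evalAt hf
  rw [hu]
  exact le_nuq_ofPowerSeries_mul u ha

lemma evalAt_toRat_ne_zero (α : Cbar C) (n : ℤ) {p : Polynomial C} (hp : p ≠ 0) :
    evalAt C α n (toRat C p) ≠ 0 := by
  rw [evalAt_eq_evalHom, evalHom_toRat]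
  exact lsEval_ne_zero α n hp

variable {ℓ r}

/-- The values of a solution to the left of a point where `ℓ_r` has no zeros bound the
next value. -/
lemma le_nuq_of_mem_solSet {v : EReal} {α : Cbar C} {b : ℤ → LS C} (hb : b ∈ SolSet C ℓ r α)
    {n : ℤ} (hn : Polynomial.aeval (α + (n : Cbar C)) (ℓ r) ≠ 0)
    (hv : ∀ i : ℕ, i < r → v ≤ nuq C (b (n + i))) : v ≤ nuq C (b (n + r)) := by
  have hr := evalAt_toRat_ne_zero α n (ne_zero_of_aeval_ne_zero hn)
  have hsol := hb n
  rw [Finset.sum_range_succ] at hsol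
  have hbr : b (n + r) =
      evalAt C α n ((toRat C (ℓ r))⁻¹) *
        -∑ i ∈ Finset.range r, evalAt C α n (toRat C (ℓ i)) * b (n + i) := by
    rw [← eq_neg_of_add_eq_zero_right hsol, ← mul_assoc]
    rw [evalAt_eq_evalHom] at hr ⊢
    rw [evalAt_eq_evalHom, map_inv₀, inv_mul_cancel₀ hr, one_mul]
  rw [hbr]
  refine le_nuq_evalAt_mul ⟨1, ℓ r, hn, by simp⟩ (le_nuq_neg (le_nuq_sum _ fun i hi => ?_))
  exact le_nuq_evalAt_mul (inLocalRing_toRat _ _) (hv i (Finset.mem_range.mp hi))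

/-- To the left of all zeros of `ℓ_r`, elements with regular coordinates are integral. -/
lemma integralAt_of_inLocalRing {α : Cbar C}
    (hα : ∀ n : ℕ, Polynomial.aeval (α - ((n + 1 : ℕ) : Cbar C)) (ℓ r) ≠ 0)
    {f : Fin r → RatFunc C} (hf : ∀ i, InLocalRing C α (f i)) : IntegralAt C ℓ r α f := by
  refine le_iInf₂ fun b hb => ?_
  unfold esub
  split_ifs with hL
  · exact le_top
  rw [EReal.sub_nonneg (Or.inr hL) (Or.inl (nuq_ne_bot _))]
  refine le_of_forall_lt_imp_le_of_dense fun c hc => ?_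
  obtain ⟨N, hN⟩ := eventually_atTop.mp (Filter.eventually_lt_of_lt_liminf hc)
  have window : ∀ d : ℕ, d ≤ N + r → ∀ i : ℕ, i < r →
      c ≤ nuq C (b (-((N + r : ℕ) : ℤ) + d + i)) := by
    intro d
    induction d with
    | zero =>
      intro _ i hi
      have hbound := (hN (N + r - i) (by omega)).le
      have hidx : -((N + r : ℕ) : ℤ) + (0 : ℕ) + i = -((N + r - i : ℕ) : ℤ) := by omega
      rwa [hidx]
    | succ d ih =>
      intro hd i hi
      rcases Nat.lt_or_ge (i + 1) r with h | h
      · convert ih (by omega) (i + 1) h using 3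
        push_cast
        ring
      · have hroot : Polynomial.aeval (α + ((-((N + r : ℕ) : ℤ) + d : ℤ) : Cbar C)) (ℓ r) ≠ 0 := by
          have hidx : (-((N + r : ℕ) : ℤ) + d : ℤ) = -((N + r - d - 1 + 1 : ℕ) : ℤ) := by omega
          rw [hidx, Int.cast_neg, Int.cast_natCast, ← sub_eq_add_neg]
          exact hα (N + r - d - 1)
        convert le_nuq_of_mem_solSet hb hroot (ih (by omega)) using 3
        omega
  refine le_nuq_sum _ fun i _ => le_nuq_evalAt_mul (by simpa using hf i) ?_
  simpa using window (N + r) le_rfl i i.isLt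

end Valuation

section Shift

variable {C ℓ r}

lemma Smap_add (f g : Fin r → RatFunc C) :
    Smap C ℓ r (f + g) = Smap C ℓ r f + Smap C ℓ r g := by
  ext1 j
  simp only [Smap, Pi.add_apply, map_add]
  split_ifs <;> ring

lemma Smap_smul (c : RatFunc C) (f : Fin r → RatFunc C) :
    Smap C ℓ r (c • f) = ratσ C c • Smap C ℓ r f := by
  ext1 j
  simp only [Smap, Pi.smul_apply, smul_eq_mul, map_mul]
  split_ifs <;> ring

lemma Smap_sum {ι : Type*} (s : Finset ι) (f : ι → Fin r → RatFunc C) :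
    Smap C ℓ r (∑ i ∈ s, f i) = ∑ i ∈ s, Smap C ℓ r (f i) :=
  map_sum (AddMonoidHom.mk' (Smap C ℓ r) Smap_add) f s

lemma Dmap_add (f g : Fin r → RatFunc C) :
    Dmap C ℓ r (f + g) = Dmap C ℓ r f + Dmap C ℓ r g := by
  simp only [Dmap, Smap_add]
  abel

lemma elemApply_Smap (hr : ℓ r ≠ 0) {α : Cbar C} (f : Fin r → RatFunc C) {b : ℤ → LS C}
    (hb : b ∈ SolSet C ℓ r α) :
    elemApply C r α (Smap C ℓ r f) b 0 = elemApply C r (α + 1) f (fun n => b (n + 1)) 0 := by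
  obtain ⟨s, rfl⟩ := Nat.exists_eq_succ_of_ne_zero (NeZero.ne r)
  have hr' : evalHom α 0 (toRat C (ℓ (s + 1))) ≠ 0 := by
    rw [← evalAt_eq_evalHom]; exact evalAt_toRat_ne_zero α 0 hr
  have hlast : lastIdx (s + 1) = Fin.last s := rfl
  have hsol := hb 0
  rw [Finset.sum_range_succ, ← Fin.sum_univ_eq_sum_range
    (fun i => evalAt C α 0 (toRat C (ℓ i)) * b (0 + i))] at hsol
  have key : ∀ j : Fin (s + 1), evalAt C α 0 (Smap C ℓ (s + 1) f j) * b (0 + (j : ℤ)) =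
      (if (j : ℕ) = 0 then 0 else
        evalAt C (α + 1) 0 (f ⟨(j : ℕ) - 1, lt_of_le_of_lt (Nat.sub_le _ _) j.isLt⟩))
          * b (0 + (j : ℤ))
      - evalAt C (α + 1) 0 (f (Fin.last s)) / evalAt C α 0 (toRat C (ℓ (s + 1))) *
        (evalAt C α 0 (toRat C (ℓ j)) * b (0 + (j : ℤ))) := by
    intro j
    simp only [← evalAt_ratσ]
    simp only [evalAt_eq_evalHom, Smap, hlast, map_sub, map_mul, map_div₀,
      apply_ite (evalHom α 0), map_zero]
    ring
  unfold elemApply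
  rw [Finset.sum_congr rfl fun j _ => key j, Finset.sum_sub_distrib, ← Finset.mul_sum,
    eq_neg_of_add_eq_zero_left hsol, Fin.sum_univ_succ, Fin.sum_univ_castSucc]
  rw [← evalAt_eq_evalHom] at hr'
  simp only [Fin.val_zero, if_true, zero_mul, zero_add, Fin.val_succ, Fin.val_castSucc,
    Fin.val_last, Nat.cast_add, Nat.cast_one, Nat.add_eq_zero_iff, one_ne_zero, and_false,
    if_false, Nat.add_sub_cancel]
  rw [mul_neg, sub_neg_eq_add, ← mul_assoc, div_mul_cancel₀ _ hr']
  rfl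

lemma IntegralAt.of_Smap (hr : ℓ r ≠ 0) {α : Cbar C} {f : Fin r → RatFunc C}
    (hf : IntegralAt C ℓ r α (Smap C ℓ r f)) : IntegralAt C ℓ r (α + 1) f := by
  refine le_iInf₂ fun b hb => ?_
  have hb' : (fun n => b (n - 1)) ∈ SolSet C ℓ r α := by
    intro n
    have := hb (n - 1)
    simp only [evalAt_add_one, sub_add_cancel] at this
    simpa only [add_sub_right_comm] using this
  have h := hf.trans (iInf₂_le _ hb')
  rw [elemApply_Smap hr f hb'] at h
  have hlim : liminf (fun n : ℕ => nuq C (b (-(n : ℤ) - 1))) atTop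
      = liminf (fun n : ℕ => nuq C (b (-(n : ℤ)))) atTop := by
    rw [← Filter.liminf_nat_add (fun n : ℕ => nuq C (b (-(n : ℤ)))) 1]
    congr! 4
    push_cast
    ring
  simpa only [add_sub_cancel_right, hlim] using h

/-- `S` preserves regularity of coordinates away from the zeros of `ℓ_r`. -/
lemma inLocalRing_Smap {α : Cbar C} (hr : Polynomial.aeval α (ℓ r) ≠ 0)
    {f : Fin r → RatFunc C} (hf : ∀ i, InLocalRing C (α + 1) (f i)) (j : Fin r) :
    InLocalRing C α (Smap C ℓ r f j) := by
  unfold Smap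
  refine .sub ?_ (.mul (inLocalRing_ratσ_iff.mpr (hf _)) ⟨_, _, hr, rfl⟩)
  split_ifs
  · exact inLocalRing_zero α
  · exact inLocalRing_ratσ_iff.mpr (hf _)

/-- `S⁻¹` preserves regularity of coordinates away from the zeros of `ℓ₀`. -/
lemma inLocalRing_of_Smap {α : Cbar C} (hr : ℓ r ≠ 0) (h0 : Polynomial.aeval α (ℓ 0) ≠ 0)
    {f : Fin r → RatFunc C} (hf : ∀ i, InLocalRing C α (Smap C ℓ r f i)) (j : Fin r) :
    InLocalRing C (α + 1) (f j) := by
  rw [← inLocalRing_ratσ_iff]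
  have hr' := toRat_ne_zero hr
  have h0' := toRat_ne_zero (ne_zero_of_aeval_ne_zero h0)
  have hlast (p : Polynomial C) :
      InLocalRing C α (ratσ C (f (lastIdx r)) * (toRat C p / toRat C (ℓ r))) := by
    have h : ratσ C (f (lastIdx r)) * (toRat C p / toRat C (ℓ r))
        = -(Smap C ℓ r f 0 * (toRat C p / toRat C (ℓ 0))) := by
      simp only [Smap, Fin.val_zero, if_true]
      field_simp
      ring
    rw [h]
    exact ((hf 0).mul ⟨_, _, h0, rfl⟩).neg
  by_cases hj : (j : ℕ) + 1 < r
  · have h := (hf ⟨j + 1, hj⟩).add (hlast (ℓ (j + 1)))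
    simpa [Smap] using h
  · have : j = lastIdx r := by
      ext
      simp only [lastIdx]
      omega
    rw [this]
    simpa [hr'] using hlast (ℓ r)

end Shift

section LocalSpan

variable {C r}

lemma mem_localSpan_stdBasis {α : Cbar C} {f : Fin r → RatFunc C} :
    f ∈ localSpan C r α (stdBasis C r) ↔ ∀ i, InLocalRing C α (f i) := by
  have h (c : Fin r → RatFunc C) : ∑ i, c i • stdBasis C r i = c := by
    ext1 j
    simp [Finset.sum_apply, stdBasis]
  refine ⟨?_, fun hf => ⟨f, hf, (h f).symm⟩⟩
  rintro ⟨c, hc, rfl⟩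
  rwa [h]

lemma mem_localSpan_self (α : Cbar C) (W : Fin r → Fin r → RatFunc C) (j : Fin r) :
    W j ∈ localSpan C r α W := by
  refine ⟨Pi.single j 1, fun i => ?_, ?_⟩
  · rcases eq_or_ne i j with rfl | h
    · simpa using inLocalRing_one α
    · simpa [h] using inLocalRing_zero α
  · simp [Pi.single_apply, ite_smul]

lemma inLocalRing_of_mem_localSpan {α : Cbar C} {W : Fin r → Fin r → RatFunc C}
    (hW : LinearIndependent (RatFunc C) W) {c : Fin r → RatFunc C}
    (hc : ∑ i, c i • W i ∈ localSpan C r α W) (i : Fin r) : InLocalRing C α (c i) := by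
  obtain ⟨d, hd, h⟩ := hc
  have h0 : ∑ i, (c i - d i) • W i = 0 := by
    simp only [sub_smul, Finset.sum_sub_distrib, h, sub_self]
  rw [sub_eq_zero.mp (Fintype.linearIndependent_iff.mp hW _ h0 i)]
  exact hd i

end LocalSpan

section Frac

variable {C ℓ r}

/-- The element of `A` with coordinates `d i / D` with respect to `W`. -/
def frac (W : Fin r → Fin r → RatFunc C) (D : Polynomial C) (d : Fin r → Polynomial C) :
    Fin r → RatFunc C :=
  (toRat C D)⁻¹ • ∑ i, toRat C (d i) • W i

lemma frac_eq_sum (W : Fin r → Fin r → RatFunc C) (D : Polynomial C)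
    (d : Fin r → Polynomial C) : frac W D d = ∑ i, (toRat C (d i) / toRat C D) • W i := by
  simp only [frac, Finset.smul_sum, smul_smul, div_eq_inv_mul]

lemma frac_add (W : Fin r → Fin r → RatFunc C) (D : Polynomial C) (d d' : Fin r → Polynomial C) :
    frac W D (d + d') = frac W D d + frac W D d' := by
  simp only [frac, Pi.add_apply, map_add, add_smul, Finset.sum_add_distrib, smul_add]

lemma frac_mul_smul (W : Fin r → Fin r → RatFunc C) (D : Polynomial C) {E : Polynomial C}
    (hE : E ≠ 0) (d : Fin r → Polynomial C) : frac W (D * E) (E • d) = frac W D d := by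
  have hE' := toRat_ne_zero hE
  simp only [frac_eq_sum, Pi.smul_apply, smul_eq_mul, map_mul]
  refine Finset.sum_congr rfl fun i _ => ?_
  rw [mul_comm (toRat C D), mul_div_mul_left _ _ hE']

lemma exists_frac_mul_eq_add (W : Fin r → Fin r → RatFunc C) {D E : Polynomial C}
    (hD : D ≠ 0) (hE : E ≠ 0) (hDE : IsCoprime D E) (d : Fin r → Polynomial C) :
    ∃ d₁ d₂ : Fin r → Polynomial C, frac W (D * E) d = frac W D d₁ + frac W E d₂ := by
  obtain ⟨u, v, huv⟩ := hDE
  refine ⟨v • d, u • d, ?_⟩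
  rw [← frac_mul_smul W D hE, ← frac_mul_smul W E hD, mul_comm E D, ← frac_add, smul_smul,
    smul_smul, ← add_smul, show E * v + D * u = 1 by rw [← huv]; ring, one_smul]

lemma frac_one_single (W : Fin r → Fin r → RatFunc C) (j : Fin r) :
    frac W 1 (Pi.single j 1) = W j := by
  have h (i : Fin r) : toRat C ((Pi.single j 1 : Fin r → Polynomial C) i)
      = if i = j then 1 else 0 := by
    rw [Pi.single_apply, apply_ite (toRat C), map_one, map_zero]
  simp [frac, h, ite_smul]

lemma Smap_frac {W : Fin r → Fin r → RatFunc C} {e : Polynomial C}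
    {M : Matrix (Fin r) (Fin r) (Polynomial C)}
    (hSW : ∀ i, Smap C ℓ r (W i) = ∑ j, (toRat C (M i j) / toRat C e) • W j)
    (D : Polynomial C) (d : Fin r → Polynomial C) :
    Smap C ℓ r (frac W D d)
      = frac W (polyσ C D * e) (Matrix.vecMul (fun i => polyσ C (d i)) M) := by
  rw [frac_eq_sum, frac_eq_sum, Smap_sum]
  simp only [Smap_smul, hSW, map_div₀, ratσ_toRat, Finset.smul_sum, smul_smul]
  rw [Finset.sum_comm]
  refine Finset.sum_congr rfl fun j _ => ?_
  rw [← Finset.sum_smul]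
  congr 1
  simp only [Matrix.vecMul, dotProduct, map_sum, map_mul, Finset.sum_div, div_mul_div_comm]

lemma Smap_frac_symm {W : Fin r → Fin r → RatFunc C} {e et : Polynomial C}
    {M Mt : Matrix (Fin r) (Fin r) (Polynomial C)} (he : e ≠ 0) (het : et ≠ 0)
    (hSW : ∀ i, Smap C ℓ r (W i) = ∑ j, (toRat C (M i j) / toRat C e) • W j)
    (hMM : Mt * M = (et * e) • (1 : Matrix (Fin r) (Fin r) (Polynomial C)))
    (D : Polynomial C) (d : Fin r → Polynomial C) :
    Smap C ℓ r (frac W (D * (polyσ C).symm et)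
      (fun i => (polyσ C).symm (Matrix.vecMul d Mt i))) = frac W (polyσ C D) d := by
  rw [Smap_frac hSW]
  simp only [map_mul, RingEquiv.apply_symm_apply]
  rw [Matrix.vecMul_vecMul, hMM, Matrix.vecMul_smul, Matrix.vecMul_one, mul_assoc,
    frac_mul_smul W _ (mul_ne_zero het he)]

lemma mul_eq_smul_one_of_inverse {e et : Polynomial C}
    {M Mt : Matrix (Fin r) (Fin r) (Polynomial C)} (he : e ≠ 0) (het : et ≠ 0)
    (hinv : ((toRat C et)⁻¹ • Mt.map (toRat C)) * ((toRat C e)⁻¹ • M.map (toRat C)) = 1) :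
    Mt * M = (et * e) • (1 : Matrix (Fin r) (Fin r) (Polynomial C)) := by
  have he' := toRat_ne_zero he
  have het' := toRat_ne_zero het
  apply Matrix.map_injective (RatFunc.algebraMap_injective C)
  have h : (Mt * M).map (toRat C) = toRat C (et * e) • 1 := by
    rw [← hinv, Matrix.map_mul, Matrix.smul_mul, Matrix.mul_smul, smul_smul, smul_smul, map_mul]
    rw [show toRat C et * toRat C e * (toRat C et)⁻¹ * (toRat C e)⁻¹ = 1 by field_simp, one_smul]
  refine h.trans ?_
  ext i j
  by_cases hij : i = j <;> simp [hij]

/-- `f` is congruent modulo summable elements to an element with denominator `E`. -/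
def IsReducible (ℓ : ℕ → Polynomial C) (W : Fin r → Fin r → RatFunc C) (E : Polynomial C)
    (f : Fin r → RatFunc C) : Prop :=
  ∃ (g : Fin r → RatFunc C) (c : Fin r → Polynomial C), f = Dmap C ℓ r g + frac W E c

lemma isReducible_frac {W : Fin r → Fin r → RatFunc C} {D E : Polynomial C} (hE : E ≠ 0)
    (h : D ∣ E) (d : Fin r → Polynomial C) : IsReducible ℓ W E (frac W D d) := by
  obtain ⟨F, rfl⟩ := h
  refine ⟨0, F • d, ?_⟩
  rw [frac_mul_smul W D (right_ne_zero_of_mul hE)]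
  have h0 : Dmap C ℓ r 0 = 0 := by simpa using Dmap_add (ℓ := ℓ) (0 : Fin r → RatFunc C) 0
  rw [h0, zero_add]

lemma IsReducible.add {W : Fin r → Fin r → RatFunc C} {E : Polynomial C}
    {f f' : Fin r → RatFunc C} (hf : IsReducible ℓ W E f) (hf' : IsReducible ℓ W E f') :
    IsReducible ℓ W E (f + f') := by
  obtain ⟨g, c, rfl⟩ := hf
  obtain ⟨g', c', rfl⟩ := hf'
  exact ⟨g + g', c + c', by rw [Dmap_add, frac_add]; abel⟩

lemma isReducible_Smap_iff {W : Fin r → Fin r → RatFunc C} {E : Polynomial C}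
    {f : Fin r → RatFunc C} : IsReducible ℓ W E (Smap C ℓ r f) ↔ IsReducible ℓ W E f := by
  constructor
  · rintro ⟨g, c, h⟩
    refine ⟨g - f, c, ?_⟩
    have hd := Dmap_add (ℓ := ℓ) (g - f) f
    rw [sub_add_cancel] at hd
    rw [hd] at h
    calc f = Smap C ℓ r f - Dmap C ℓ r f := by simp [Dmap]
      _ = _ := by rw [h]; abel
  · rintro ⟨g, c, h⟩
    refine ⟨f + g, c, ?_⟩
    rw [Dmap_add, add_assoc, ← h]
    simp [Dmap]

lemma isReducible_frac_of_polyσ {W : Fin r → Fin r → RatFunc C} {e E D : Polynomial C}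
    {M : Matrix (Fin r) (Fin r) (Polynomial C)} (he : e ≠ 0) (hE : E ≠ 0) (heE : e ∣ E)
    (hSW : ∀ i, Smap C ℓ r (W i) = ∑ j, (toRat C (M i j) / toRat C e) • W j)
    (hD : D ≠ 0) (hcop : IsCoprime (polyσ C D) e)
    (h : ∀ d, IsReducible ℓ W E (frac W (polyσ C D) d)) (d : Fin r → Polynomial C) :
    IsReducible ℓ W E (frac W D d) := by
  rw [← isReducible_Smap_iff, Smap_frac hSW]
  obtain ⟨d₁, d₂, hd⟩ := exists_frac_mul_eq_add W
    ((map_ne_zero_iff _ (polyσ C).injective).mpr hD) he hcop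
    (Matrix.vecMul (fun i => polyσ C (d i)) M)
  rw [hd]
  exact (h d₁).add (isReducible_frac hE heE d₂)

lemma isReducible_frac_polyσ {W : Fin r → Fin r → RatFunc C} {e et E D : Polynomial C}
    {M Mt : Matrix (Fin r) (Fin r) (Polynomial C)} (he : e ≠ 0) (het : et ≠ 0) (hE : E ≠ 0)
    (heE : et * e ∣ E)
    (hSW : ∀ i, Smap C ℓ r (W i) = ∑ j, (toRat C (M i j) / toRat C e) • W j)
    (hMM : Mt * M = (et * e) • (1 : Matrix (Fin r) (Fin r) (Polynomial C)))
    (hD : D ≠ 0) (hcop : IsCoprime D ((polyσ C).symm et))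
    (h : ∀ d, IsReducible ℓ W E (frac W D d)) (d : Fin r → Polynomial C) :
    IsReducible ℓ W E (frac W (polyσ C D) d) := by
  rw [← Smap_frac_symm he het hSW hMM, isReducible_Smap_iff]
  obtain ⟨d₁, d₂, hd⟩ := exists_frac_mul_eq_add W hD
    ((map_ne_zero_iff _ (polyσ C).symm.injective).mpr het) hcop
    (fun i => (polyσ C).symm (Matrix.vecMul d Mt i))
  rw [hd]
  refine (h d₁).add ?_
  rw [← isReducible_Smap_iff, Smap_frac hSW]
  refine isReducible_frac hE ?_ _
  rwa [RingEquiv.apply_symm_apply]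

end Frac

section Orbits

variable {C ℓ r} {I : ℕ}

namespace SuitableData

lemma exists_β_eq_minR_add (D : SuitableData C ℓ r I) (i : Fin I) :
    ∃ N : ℕ, D.β i = D.minR i + (N : Cbar C) ∧
      ∀ n : ℤ, Polynomial.aeval (D.β i + (n : Cbar C)) (ℓ 0 * ℓ r) = 0 → -(N : ℤ) ≤ n ∧ n ≤ 0 := by
  obtain ⟨a, ha⟩ := D.minR_le_maxR i
  obtain ⟨b, hb⟩ := D.maxR_le_β i
  have hβ : D.β i = D.minR i + ((a + b : ℕ) : Cbar C) := by
    rw [hb, ha]; push_cast; ring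
  refine ⟨a + b, hβ, fun n hn => ?_⟩
  have hn' : D.β i + (n : Cbar C) = D.minR i + (((a + b : ℕ) + n : ℤ) : Cbar C) := by
    rw [hβ]; push_cast; ring
  rw [hn'] at hn
  obtain ⟨h0, k, hk⟩ := D.roots_between i _ hn
  rw [ha, add_assoc, add_right_inj] at hk
  have hk' : (a : ℤ) = ((a + b : ℕ) + n : ℤ) + k := by exact_mod_cast hk
  omega

lemma eq_of_β_eq_add (D : SuitableData C ℓ r I) {i j : Fin I} {n : ℤ}
    (h : D.β i = D.β j + (n : Cbar C)) : i = j ∧ n = 0 := by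
  by_cases hij : i = j
  · subst hij
    exact ⟨rfl, by simpa using h⟩
  · exact absurd h (D.orbits_distinct i j hij n)

lemma memZ_β_add_iff (D : SuitableData C ℓ r I) {i : Fin I} {N : ℕ}
    (hN : D.β i = D.minR i + (N : Cbar C)) (n : ℤ) :
    memZ C ℓ r D (D.β i + (n : Cbar C)) ↔ -(N : ℤ) < n ∧ n ≤ 0 := by
  constructor
  · rintro ⟨j, ⟨m, hm⟩, k, hk1, hk⟩
    have hm' : D.β j = D.β i + ((n + m : ℤ) : Cbar C) := by rw [← hm]; push_cast; ring
    obtain ⟨rfl, h⟩ := D.eq_of_β_eq_add hm'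
    rw [hN, add_assoc, add_right_inj] at hk
    have hk' : (N : ℤ) + n = k := by exact_mod_cast hk
    omega
  · rintro ⟨h1, h2⟩
    refine ⟨i, ⟨(-n).toNat, ?_⟩, ((N : ℤ) + n).toNat, by omega, ?_⟩
    · have : (((-n).toNat : ℤ) : Cbar C) = ((-n : ℤ) : Cbar C) := by
        rw [Int.toNat_of_nonneg (by omega)]
      rw [← Int.cast_natCast, this]
      push_cast
      ring
    · have : ((((N : ℤ) + n).toNat : ℤ) : Cbar C) = (((N : ℤ) + n : ℤ) : Cbar C) := by
        rw [Int.toNat_of_nonneg (by omega)]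
      rw [← Int.cast_natCast, this, hN]
      push_cast
      ring

/-- The set of the `β i` is stable under conjugation. -/
lemma exists_conj_β_eq (D : SuitableData C ℓ r I) (φ : Cbar C ≃ₐ[C] Cbar C) (i : Fin I) :
    ∃ j, φ (D.β i) = D.β j := by
  have conj_root (ψ : Cbar C ≃ₐ[C] Cbar C) {ξ : Cbar C}
      (h : Polynomial.aeval ξ (ℓ 0 * ℓ r) = 0) : Polynomial.aeval (ψ ξ) (ℓ 0 * ℓ r) = 0 := by
    rw [Polynomial.aeval_algEquiv, AlgHom.comp_apply, h, map_zero]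
  obtain ⟨j, m, hm⟩ := D.orbits_cover _ (conj_root φ (D.maxR_root i))
  have hmax : φ (D.maxR i) = D.maxR j := by
    obtain ⟨a, ha⟩ := D.minR_le_maxR j
    obtain ⟨b, hb⟩ := D.maxR_le_β j
    have h1 : φ (D.maxR i) = D.minR j + ((a + b + m : ℤ) : Cbar C) := by
      rw [hm, hb, ha]; push_cast; ring
    obtain ⟨-, k, hk⟩ := D.roots_between j _ (h1 ▸ conj_root φ (D.maxR_root i))
    rw [← h1] at hk
    have h2 : φ.symm (D.maxR j) = D.maxR i + (k : Cbar C) := by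
      rw [hk, map_add, AlgEquiv.symm_apply_apply, map_natCast]
    obtain ⟨a', ha'⟩ := D.minR_le_maxR i
    have h3 : φ.symm (D.maxR j) = D.minR i + ((a' + k : ℤ) : Cbar C) := by
      rw [h2, ha']; push_cast; ring
    obtain ⟨-, k', hk'⟩ := D.roots_between i _ (h3 ▸ conj_root φ.symm (D.maxR_root j))
    rw [← h3, h2, add_assoc, left_eq_add] at hk'
    have hk0 : k + k' = 0 := by exact_mod_cast hk'
    have : k = 0 := by omega
    rw [hk, this, Nat.cast_zero, add_zero]
  refine ⟨j, ?_⟩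
  have h := D.conj_compat φ i j hmax
  obtain ⟨b, hb⟩ := D.maxR_le_β i
  rw [hb, add_sub_cancel_left] at h
  rw [hb, map_add, map_natCast, hmax, h]
  ring

end SuitableData

end Orbits

section Suitable

variable {C ℓ r} {I : ℕ} {D : SuitableData C ℓ r I} {W : Fin r → Fin r → RatFunc C}
  {e et : Polynomial C} {M Mt : Matrix (Fin r) (Fin r) (Polynomial C)}

/-- The denominator of the matrix of `S` with respect to a suitable basis has no zeros to the
right of the points `β i`. -/
lemma IsSuitableBasis.aeval_denom_ne_zero (hW : IsSuitableBasis C ℓ r D W) (he : e ≠ 0)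
    (hSW : ∀ i, Smap C ℓ r (W i) = ∑ j, (toRat C (M i j) / toRat C e) • W j)
    (hgcd : ∀ d : Polynomial C, d ∣ e → (∀ i j, d ∣ M i j) → IsUnit d)
    (i : Fin I) {n : ℤ} (hn : 0 < n) : Polynomial.aeval (D.β i + (n : Cbar C)) e ≠ 0 := by
  obtain ⟨N, hN, hroot⟩ := D.exists_β_eq_minR_add i
  have hstd (n : ℤ) (hn : 0 < n) := hW.2.2 (D.β i + (n : Cbar C))
    (by rw [D.memZ_β_add_iff hN]; omega)
  have hr : Polynomial.aeval (D.β i + (n : Cbar C)) (ℓ r) ≠ 0 := by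
    intro h0
    have := hroot n (by rw [map_mul, h0, mul_zero])
    omega
  refine aeval_ne_zero_of_inLocalRing he hgcd fun j =>
    inLocalRing_of_mem_localSpan hW.1.1 ?_
  rw [← hSW, hstd n hn, mem_localSpan_stdBasis]
  refine inLocalRing_Smap hr (mem_localSpan_stdBasis.mp ?_)
  rw [add_assoc, ← Int.cast_one, ← Int.cast_add, ← hstd (n + 1) (by omega)]
  exact mem_localSpan_self _ W j

/-- The denominator of the inverse of the matrix of `S` with respect to a suitable basis has no
zeros to the left of the points `β i`. -/
lemma IsSuitableBasis.aeval_denom_inv_ne_zero (hW : IsSuitableBasis C ℓ r D W)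
    (hℓ : ℓ 0 * ℓ r ≠ 0) (he : e ≠ 0) (het : et ≠ 0)
    (hSW : ∀ i, Smap C ℓ r (W i) = ∑ j, (toRat C (M i j) / toRat C e) • W j)
    (hMM : Mt * M = (et * e) • (1 : Matrix (Fin r) (Fin r) (Polynomial C)))
    (hgcdt : ∀ d : Polynomial C, d ∣ et → (∀ i j, d ∣ Mt i j) → IsUnit d)
    (i : Fin I) {n : ℤ} (hn : n < 0) : Polynomial.aeval (D.β i + (n : Cbar C)) et ≠ 0 := by
  obtain ⟨N, hN, hroot⟩ := D.exists_β_eq_minR_add i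
  have hℓr := right_ne_zero_of_mul hℓ
  have hα : D.β i + (n : Cbar C) + 1 = D.β i + ((n + 1 : ℤ) : Cbar C) := by push_cast; ring
  have hstd (m : ℤ) (hm : m ≤ -N) := hW.2.2 (D.β i + (m : Cbar C))
    (by rw [D.memZ_β_add_iff hN]; omega)
  refine aeval_ne_zero_of_inLocalRing het hgcdt fun j k => ?_
  have hV := Smap_frac_symm he het hSW hMM 1 (Pi.single j 1)
  rw [map_one, frac_one_single, one_mul, Matrix.single_one_vecMul] at hV
  rw [← RingEquiv.apply_symm_apply (polyσ C) (Mt j k), ← RingEquiv.apply_symm_apply (polyσ C) et,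
    ← ratσ_toRat, ← ratσ_toRat, ← map_div₀, inLocalRing_ratσ_iff]
  refine inLocalRing_of_mem_localSpan
    (c := fun k => toRat C ((polyσ C).symm (Mt j k)) / toRat C ((polyσ C).symm et)) hW.1.1 ?_ k
  rw [← frac_eq_sum W _ fun k => (polyσ C).symm (Mt j k)]
  rcases lt_or_ge n (-(N : ℤ)) with hlt | hge
  · have h0 : Polynomial.aeval (D.β i + (n : Cbar C)) (ℓ 0) ≠ 0 := by
      intro h0
      have := hroot n (by rw [map_mul, h0, zero_mul])
      omega
    rw [hα, hstd (n + 1) (by omega), mem_localSpan_stdBasis, ← hα]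
    refine inLocalRing_of_Smap hℓr h0 (mem_localSpan_stdBasis.mp ?_)
    erw [hV]
    rw [← hstd n hlt.le]
    exact mem_localSpan_self _ W j
  · have hint : IntegralAt C ℓ r (D.β i + (n : Cbar C)) (W j) := by
      rcases eq_or_lt_of_le hge with heq | hgt
      · refine integralAt_of_inLocalRing (fun m h0 => ?_) (mem_localSpan_stdBasis.mp ?_)
        · have := hroot (n - (m + 1 : ℕ)) (by
            rw [map_mul, Int.cast_sub, Int.cast_natCast, ← add_sub_assoc, h0, mul_zero])
          omega
        · rw [← hstd n heq.ge]
          exact mem_localSpan_self _ W j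
      · exact (hW.2.1 _ ((D.memZ_β_add_iff hN n).mpr ⟨hgt, hn.le⟩)).2.1 j
    refine (hW.2.1 _ ?_).2.2 _ (.of_Smap hℓr (by erw [hV]; exact hint))
    rw [hα, D.memZ_β_add_iff hN]
    omega

/-- The zeros of shifts of a power of the minimal polynomial of `β i`. -/
lemma exists_eq_β_sub_of_aeval_polyShift (D : SuitableData C ℓ r I) {i : Fin I} {m : ℕ} {k : ℤ}
    {ξ : Cbar C} (h : Polynomial.aeval ξ (polyShift C k (minpoly C (D.β i) ^ m)) = 0) :
    ∃ j, ξ = D.β j + ((-k : ℤ) : Cbar C) := by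
  rw [aeval_polyShift, map_pow] at h
  obtain ⟨φ, hφ⟩ := minpoly.exists_algEquiv_of_root'
    (Algebra.IsAlgebraic.isAlgebraic (R := C) (D.β i)) (eq_zero_of_pow_eq_zero h)
  obtain ⟨j, hj⟩ := D.exists_conj_β_eq φ i
  refine ⟨j, ?_⟩
  rw [← hj, hφ]
  push_cast
  ring

end Suitable

theorem statement12 [NeZero r] (hr : 1 ≤ r) (hℓ : ℓ 0 * ℓ r ≠ 0) {I : ℕ}
    (D : SuitableData C ℓ r I) (W : Fin r → (Fin r → RatFunc C))
    (hW : IsSuitableBasis C ℓ r D W)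
    (e et : Polynomial C) (M Mt : Matrix (Fin r) (Fin r) (Polynomial C))
    (he : e ≠ 0) (het : et ≠ 0)
    (hSW : ∀ i, Smap C ℓ r (W i) = ∑ j, (toRat C (M i j) / toRat C e) • W j)
    (hgcd : ∀ d : Polynomial C, d ∣ e → (∀ i j, d ∣ M i j) → IsUnit d)
    (hgcdt : ∀ d : Polynomial C, d ∣ et → (∀ i j, d ∣ Mt i j) → IsUnit d)
    (hinv : ((toRat C e)⁻¹ • M.map (toRat C)) * ((toRat C et)⁻¹ • Mt.map (toRat C)) = 1 ∧
      ((toRat C et)⁻¹ • Mt.map (toRat C)) * ((toRat C e)⁻¹ • M.map (toRat C)) = 1)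
    (q : Polynomial C) (a : Fin r → Polynomial C) (k : ℤ)
    (i₀ : Fin I) (m : ℕ) (hm : 0 < m) (hq : q = (minpoly C (D.β i₀)) ^ m) :
    ∃ (g : Fin r → RatFunc C) (c : Fin r → Polynomial C),
      (toRat C (polyShift C k q))⁻¹ • (∑ i, toRat C (a i) • W i)
        = Dmap C ℓ r g + (toRat C (q * e * et))⁻¹ • ∑ i, toRat C (c i) • W i := by
  subst hq
  set q : Polynomial C := minpoly C (D.β i₀) ^ m
  have hq0 : q ≠ 0 := pow_ne_zero _
    (minpoly.ne_zero (Algebra.IsAlgebraic.isAlgebraic (R := C) (D.β i₀)).isIntegral)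
  have hE : q * e * et ≠ 0 := mul_ne_zero (mul_ne_zero hq0 he) het
  have hMM := mul_eq_smul_one_of_inverse he het hinv.2
  have hshift (k : ℤ) : polyShift C k q ≠ 0 :=
    (map_ne_zero_iff _ (polyShiftEquiv C (k : C)).injective).mpr hq0
  have hcop_e (k : ℤ) (hk : k < 0) : IsCoprime (polyShift C k q) e := by
    rw [Polynomial.isCoprime_iff_aeval_ne_zero_of_isAlgClosed C (Cbar C)]
    refine fun ξ => or_iff_not_imp_left.mpr fun h => ?_
    obtain ⟨j, rfl⟩ := exists_eq_β_sub_of_aeval_polyShift D (not_not.mp h)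
    exact hW.aeval_denom_ne_zero he hSW hgcd j (by omega)
  have hcop_et (k : ℤ) (hk : 0 ≤ k) : IsCoprime (polyShift C k q) ((polyσ C).symm et) := by
    rw [Polynomial.isCoprime_iff_aeval_ne_zero_of_isAlgClosed C (Cbar C)]
    refine fun ξ => or_iff_not_imp_left.mpr fun h => ?_
    obtain ⟨j, rfl⟩ := exists_eq_β_sub_of_aeval_polyShift D (not_not.mp h)
    rw [aeval_polyσ_symm, add_sub_assoc, ← Int.cast_one, ← Int.cast_sub]
    exact hW.aeval_denom_inv_ne_zero hℓ he het hSW hMM hgcdt j (by omega)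
  suffices h : ∀ a, IsReducible ℓ W (q * e * et) (frac W (polyShift C k q) a) from h a
  clear a
  induction k using Int.induction_on with
  | zero =>
    rw [polyShift_zero]
    exact isReducible_frac hE ⟨e * et, by ring⟩
  | succ k ih =>
    rw [← polyσ_polyShift]
    exact isReducible_frac_polyσ he het hE ⟨q, by ring⟩ hSW hMM (hshift k)
      (hcop_et k (by omega)) ih
  | pred k ih =>
    have hσ : polyσ C (polyShift C (-(k : ℤ) - 1) q) = polyShift C (-(k : ℤ)) q := by
      rw [polyσ_polyShift, sub_add_cancel]
    rcases Nat.eq_zero_or_pos k with rfl | hk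
    · intro a
      rw [← isReducible_Smap_iff, Smap_frac hSW, hσ, Nat.cast_zero, neg_zero, polyShift_zero]
      exact isReducible_frac hE ⟨et, by ring⟩ _
    · refine isReducible_frac_of_polyσ he hE ⟨q * et, by ring⟩ hSW (hshift _) ?_ ?_
      · rw [hσ]
        exact hcop_e _ (by omega)
      · rwa [hσ]

end PRec
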